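/- For α ∈ ℂ with α ≠ 1, let N_08^α be the 4-dimensional ℂ-algebra with basis e_1,e_2,e_3,e_4 and only nonzero basis products e_1e_1 = e_3, e_1e_2 = e_4, e_2e_1 = −α e_3, e_2e_2 = −e_4. Each of the six bilinear forms Δ₁₂, Δ₂₁, Δ₁₃−αΔ₂₃, Δ₁₄−Δ₂₄, Δ₃₁, Δ₄₂ is a cocycle on N_08^α, and their cosets modulo B²(N_08^α,ℂ) form a basis of H²(N_08^α,ℂ); in particular dim H²(N_08^α,ℂ) = 6 for every α ≠ 1. -/

import Mathlib

/-- The elementary bilinear multiplication on `ℂ^n` sending `(x, y)` to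
`(x_i * y_j) • e_k`; the concrete algebra below is a sum of such terms. -/
noncomputable def T {n : ℕ} (i j k : Fin n) :
    (Fin n → ℂ) →ₗ[ℂ] (Fin n → ℂ) →ₗ[ℂ] (Fin n → ℂ) :=
  LinearMap.mk₂ ℂ (fun x y => (x i * y j) • (Pi.single k 1 : Fin n → ℂ))
    (fun x x' y => by simp [add_mul, add_smul])
    (fun c x y => by simp [smul_eq_mul, smul_smul, mul_assoc])
    (fun x y y' => by simp [mul_add, add_smul])
    (fun c x y => by simp [smul_eq_mul, smul_smul, mul_left_comm])

/-- The bilinear form `Δ_{ij}` on `ℂ^n` (0-indexed): `Δ_{ij}(x,y) = x_i y_j`,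
so that `Δ_{ij}(e_l, e_m) = δ_{il} δ_{jm}`. -/
noncomputable def D {n : ℕ} (i j : Fin n) :
    (Fin n → ℂ) →ₗ[ℂ] (Fin n → ℂ) →ₗ[ℂ] ℂ :=
  LinearMap.mk₂ ℂ (fun x y => x i * y j)
    (fun x x' y => by simp [add_mul])
    (fun c x y => by simp [mul_assoc])
    (fun x y y' => by simp [mul_add])
    (fun c x y => by simp [smul_eq_mul, mul_left_comm])

/-- The cocycle condition: `θ(xy,z) = θ(xz,y)` and `θ(x,yz) = θ(y,xz)`. -/
def IsCocycle {A V : Type*} [AddCommGroup A] [Module ℂ A] [AddCommGroup V] [Module ℂ V]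
    (m : A →ₗ[ℂ] A →ₗ[ℂ] A) (θ : A →ₗ[ℂ] A →ₗ[ℂ] V) : Prop :=
  (∀ x y z : A, θ (m x y) z = θ (m x z) y) ∧ (∀ x y z : A, θ x (m y z) = θ y (m x z))

/-- `Z²(A,ℂ)`: the space of scalar-valued cocycles. -/
noncomputable def Zsub {A : Type*} [AddCommGroup A] [Module ℂ A]
    (m : A →ₗ[ℂ] A →ₗ[ℂ] A) : Submodule ℂ (A →ₗ[ℂ] A →ₗ[ℂ] ℂ) where
  carrier := {θ | IsCocycle m θ}
  add_mem' := by
    rintro θ η ⟨h1, h2⟩ ⟨g1, g2⟩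
    refine ⟨fun x y z => ?_, fun x y z => ?_⟩
    · simp only [LinearMap.add_apply]
      rw [h1 x y z, g1 x y z]
    · simp only [LinearMap.add_apply]
      rw [h2 x y z, g2 x y z]
  zero_mem' := ⟨fun x y z => by simp, fun x y z => by simp⟩
  smul_mem' := by
    rintro c θ ⟨h1, h2⟩
    refine ⟨fun x y z => ?_, fun x y z => ?_⟩
    · simp only [LinearMap.smul_apply]
      rw [h1 x y z]
    · simp only [LinearMap.smul_apply]
      rw [h2 x y z]

/-- The coboundary map `f ↦ δf = ((x,y) ↦ f(xy))`. -/
noncomputable def cobound {A : Type*} [AddCommGroup A] [Module ℂ A]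
    (m : A →ₗ[ℂ] A →ₗ[ℂ] A) : (A →ₗ[ℂ] ℂ) →ₗ[ℂ] (A →ₗ[ℂ] A →ₗ[ℂ] ℂ) where
  toFun f := m.compr₂ f
  map_add' f g := by ext x y; simp [LinearMap.compr₂_apply]
  map_smul' c f := by ext x y; simp [LinearMap.compr₂_apply]

/-- `B²(A,ℂ)`: the space of scalar-valued coboundaries. -/
noncomputable def Bsub {A : Type*} [AddCommGroup A] [Module ℂ A]
    (m : A →ₗ[ℂ] A →ₗ[ℂ] A) : Submodule ℂ (A →ₗ[ℂ] A →ₗ[ℂ] ℂ) :=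
  LinearMap.range (cobound m)

/-- The coset of a bilinear form modulo `B²(A,ℂ)`. -/
noncomputable def cls {A : Type*} [AddCommGroup A] [Module ℂ A]
    (m : A →ₗ[ℂ] A →ₗ[ℂ] A) (θ : A →ₗ[ℂ] A →ₗ[ℂ] ℂ) :
    (A →ₗ[ℂ] A →ₗ[ℂ] ℂ) ⧸ Bsub m :=
  (Bsub m).mkQ θ

/-- `H²(A,ℂ) = Z²(A,ℂ)/B²(A,ℂ)`, realized as the image of the cocycles in the
quotient of the space of all bilinear forms by the coboundaries. -/
noncomputable def H2 {A : Type*} [AddCommGroup A] [Module ℂ A]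
    (m : A →ₗ[ℂ] A →ₗ[ℂ] A) : Submodule ℂ ((A →ₗ[ℂ] A →ₗ[ℂ] ℂ) ⧸ Bsub m) :=
  (Zsub m).map (Bsub m).mkQ

/-- The algebra `N_08^α` on `ℂ^4`: `e_1 e_1 = e_3`, `e_1 e_2 = e_4`, `e_2 e_1 = -α e_3`, `e_2 e_2 = -e_4`. -/
noncomputable def mul (α : ℂ) : (Fin 4 → ℂ) →ₗ[ℂ] (Fin 4 → ℂ) →ₗ[ℂ] (Fin 4 → ℂ) :=
  T 0 0 2 + T 0 1 3 - α • T 1 0 2 - T 1 1 3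

/-- The forms `Δ₁₂, Δ₂₁, Δ₁₃−αΔ₂₃, Δ₁₄−Δ₂₄, Δ₃₁, Δ₄₂` (0-indexed). -/
noncomputable def forms (α : ℂ) : Fin 6 → ((Fin 4 → ℂ) →ₗ[ℂ] (Fin 4 → ℂ) →ₗ[ℂ] ℂ) :=
  ![D 0 1, D 1 0, D 0 2 - α • D 1 2, D 0 3 - D 1 3, D 2 0, D 3 1]

theorem mul_apply_eq (α : ℂ) (x y : Fin 4 → ℂ) :
    mul α x y = ![0, 0, x 0 * y 0 - α * (x 1 * y 0), x 0 * y 1 - x 1 * y 1] := by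
  ext k
  fin_cases k <;> simp [mul, T]

theorem D_apply {n : ℕ} (i j : Fin n) (x y : Fin n → ℂ) : D i j x y = x i * y j := rfl

theorem isCocycle_forms (α : ℂ) (i : Fin 6) : IsCocycle (mul α) (forms α i) := by
  constructor <;> intro x y z <;> fin_cases i <;>
    simp [forms, D_apply, mul_apply_eq] <;> ring

theorem sum_smul_forms_apply (α : ℂ) (c : Fin 6 → ℂ) (x y : Fin 4 → ℂ) :
    (∑ i, c i • forms α i) x y =
      c 0 * (x 0 * y 1) + c 1 * (x 1 * y 0) + c 2 * (x 0 * y 2 - α * (x 1 * y 2)) +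
        c 3 * (x 0 * y 3 - x 1 * y 3) + c 4 * (x 2 * y 0) + c 5 * (x 3 * y 1) := by
  simp [Fin.sum_univ_six, forms, D_apply]

theorem cobound_apply_eq (α : ℂ) (f : (Fin 4 → ℂ) →ₗ[ℂ] ℂ) (x y : Fin 4 → ℂ) :
    cobound (mul α) f x y =
      (x 0 * y 0 - α * (x 1 * y 0)) * f (Pi.single 2 1) +
        (x 0 * y 1 - x 1 * y 1) * f (Pi.single 3 1) := by
  change f (mul α x y) = _
  simp [mul, T]
  ring

theorem linearIndependent_cls_forms (α : ℂ) :
    LinearIndependent ℂ fun i => cls (mul α) (forms α i) := by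
  rw [Fintype.linearIndependent_iff]
  intro c hc
  have hmem : ∑ i, c i • forms α i ∈ Bsub (mul α) := by
    rw [← Submodule.ker_mkQ (Bsub (mul α)), LinearMap.mem_ker]
    simpa [cls] using hc
  obtain ⟨f, hf⟩ := hmem
  have key (j k : Fin 4) := LinearMap.congr_fun₂ hf (Pi.single j 1) (Pi.single k 1)
  simp only [cobound_apply_eq, sum_smul_forms_apply] at key
  have h00 := key 0 0
  have h01 := key 0 1
  have h10 := key 1 0
  have h11 := key 1 1
  have h02 := key 0 2
  have h03 := key 0 3
  have h20 := key 2 0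
  have h31 := key 3 1
  simp at h00 h01 h10 h11 h02 h03 h20 h31
  simp only [h00, h11, mul_zero, neg_zero] at h01 h10
  intro i
  fin_cases i
  exacts [h01.symm, h10.symm, h02.symm, h03.symm, h20.symm, h31.symm]

theorem IsCocycle.eq_cobound_add_sum_forms {α : ℂ} (hα : α ≠ 1)
    {θ : (Fin 4 → ℂ) →ₗ[ℂ] (Fin 4 → ℂ) →ₗ[ℂ] ℂ} (hθ : IsCocycle (mul α) θ) :
    ∃ (f : (Fin 4 → ℂ) →ₗ[ℂ] ℂ) (c : Fin 6 → ℂ),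
      θ = cobound (mul α) f + ∑ i, c i • forms α i := by
  set e : Fin 4 → Fin 4 → ℂ := fun i => Pi.single i 1 with he
  obtain ⟨hl, hr⟩ := hθ
  have m00 : mul α (e 0) (e 0) = e 2 := by
    rw [mul_apply_eq]; ext k; fin_cases k <;> simp [he]
  have m01 : mul α (e 0) (e 1) = e 3 := by
    rw [mul_apply_eq]; ext k; fin_cases k <;> simp [he]
  have m10 : mul α (e 1) (e 0) = -α • e 2 := by
    rw [mul_apply_eq]; ext k; fin_cases k <;> simp [he]
  have m11 : mul α (e 1) (e 1) = -e 3 := by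
    rw [mul_apply_eq]; ext k; fin_cases k <;> simp [he]
  have mr2 (x) : mul α x (e 2) = 0 := by
    rw [mul_apply_eq]; ext k; fin_cases k <;> simp [he]
  have mr3 (x) : mul α x (e 3) = 0 := by
    rw [mul_apply_eq]; ext k; fin_cases k <;> simp [he]
  have a1 := hl (e 0) (e 0) (e 1)
  have a2 := hl (e 1) (e 0) (e 1)
  have b1 := hr (e 1) (e 0) (e 0)
  have b2 := hr (e 1) (e 0) (e 1)
  have h22 := hl (e 0) (e 0) (e 2)
  have h23 := hl (e 0) (e 0) (e 3)
  have h32 := hl (e 0) (e 1) (e 2)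
  have h33 := hl (e 0) (e 1) (e 3)
  simp only [m00, m01, m10, m11, mr2, mr3, map_neg, map_smul, LinearMap.neg_apply,
    LinearMap.smul_apply, smul_eq_mul, map_zero, LinearMap.zero_apply]
    at a1 a2 b1 b2 h22 h23 h32 h33
  have h21 : θ (e 2) (e 1) = 0 :=
    (mul_eq_zero.mp (by linear_combination a2 + a1 :
      (1 - α) * θ (e 2) (e 1) = 0)).resolve_left (sub_ne_zero.mpr hα.symm)
  have h30 : θ (e 3) (e 0) = 0 := a1 ▸ h21
  refine ⟨θ (e 0) (e 0) • LinearMap.proj 2 - θ (e 1) (e 1) • LinearMap.proj 3,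
    ![θ (e 0) (e 1) + θ (e 1) (e 1), θ (e 1) (e 0) + α * θ (e 0) (e 0), θ (e 0) (e 2),
      θ (e 0) (e 3), θ (e 2) (e 0), θ (e 3) (e 1)], ?_⟩
  refine LinearMap.pi_ext' fun i => LinearMap.ext_ring <|
    LinearMap.pi_ext' fun j => LinearMap.ext_ring ?_
  change θ (e i) (e j) = cobound (mul α) _ (e i) (e j) + (∑ i, _ • forms α i) (e i) (e j)
  rw [cobound_apply_eq, sum_smul_forms_apply]
  simp only [he] at *
  fin_cases i <;> fin_cases j <;> simp [h21, h22, h23, h30, h32, h33, b1, b2, mul_comm]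

theorem span_cls_forms {α : ℂ} (hα : α ≠ 1) :
    Submodule.span ℂ (Set.range fun i => cls (mul α) (forms α i)) = H2 (mul α) := by
  apply le_antisymm
  · rw [Submodule.span_le]
    rintro _ ⟨i, rfl⟩
    exact Submodule.mem_map_of_mem (isCocycle_forms α i)
  · rintro _ ⟨θ, hθ, rfl⟩
    obtain ⟨f, c, rfl⟩ := IsCocycle.eq_cobound_add_sum_forms hα hθ
    have hf : (Bsub (mul α)).mkQ (cobound (mul α) f) = 0 :=
      (Submodule.Quotient.mk_eq_zero _).mpr ⟨f, rfl⟩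
    rw [map_add, hf, zero_add, map_sum]
    refine Submodule.sum_mem _ fun i _ => ?_
    rw [map_smul]
    exact Submodule.smul_mem _ _ (Submodule.subset_span ⟨i, rfl⟩)

/-- The listed forms are cocycles, their cosets modulo `B²` form a basis of `H²`,
and in particular `dim H² = 6`. -/
theorem secondCohomology_N08 (α : ℂ) (hα : α ≠ 1) :
    (∀ i, IsCocycle (mul α) (forms α i)) ∧
    LinearIndependent ℂ (fun i => cls (mul α) (forms α i)) ∧
    Submodule.span ℂ (Set.range fun i => cls (mul α) (forms α i)) = H2 (mul α) ∧
    Module.finrank ℂ (H2 (mul α)) = 6 := by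
  refine ⟨isCocycle_forms α, linearIndependent_cls_forms α, span_cls_forms hα, ?_⟩
  rw [← span_cls_forms hα, finrank_span_eq_card (linearIndependent_cls_forms α),
    Fintype.card_fin]
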